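/- arXiv:2401.01760 — 2 statements merged into one kernel-verified Lean document; each statement's English description precedes it below -/
import Mathlib

section
/- For every n ≥ 1 and all real numbers x, y, s: Σ_{π ∈ S_n} x^{basc(π)} y^{des(π)} s^{suc(π)} = Σ_{π ∈ S_n} x^{êxc(π)} y^{drop(π)} s^{f̂ix(π)}. -/
open Finset

namespace SucEuler

/-- One-line notation word of a permutation: `word π i` is the value (in `1..n`)
at position `i ∈ {1,…,n}`, and `0` for positions outside `{1,…,n}`
(this implements the conventions `π(0)=π(n+1)=0`). -/
def word {n : ℕ} (π : Equiv.Perm (Fin n)) (i : ℕ) : ℕ :=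
  if h : 1 ≤ i ∧ i ≤ n then ((π ⟨i - 1, by omega⟩ : Fin n) : ℕ) + 1 else 0

/-- number of descents -/
def des {n : ℕ} (π : Equiv.Perm (Fin n)) : ℕ :=
  ((Finset.Icc 1 (n - 1)).filter fun i => word π (i + 1) < word π i).card

/-- number of ascents -/
def asc {n : ℕ} (π : Equiv.Perm (Fin n)) : ℕ :=
  ((Finset.Icc 1 (n - 1)).filter fun i => word π i < word π (i + 1)).card

/-- number of successions -/
def suc {n : ℕ} (π : Equiv.Perm (Fin n)) : ℕ :=
  ((Finset.Icc 1 (n - 1)).filter fun i => word π (i + 1) = word π i + 1).card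

/-- number of big ascents -/
def basc {n : ℕ} (π : Equiv.Perm (Fin n)) : ℕ :=
  ((Finset.Icc 1 (n - 1)).filter fun i => word π i + 2 ≤ word π (i + 1)).card

/-- number of excedances -/
def excStat {n : ℕ} (σ : Equiv.Perm (Fin n)) : ℕ :=
  (Finset.univ.filter fun i : Fin n => i < σ i).card

/-- number of fixed points -/
def fixStat {n : ℕ} (σ : Equiv.Perm (Fin n)) : ℕ :=
  (Finset.univ.filter fun i : Fin n => σ i = i).card

/-- number of drops -/
def dropStat {n : ℕ} (σ : Equiv.Perm (Fin n)) : ℕ :=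
  (Finset.univ.filter fun i : Fin n => σ i < i).card

/-- number of excedances at positions `i ≥ 2` -/
def excHat {n : ℕ} (σ : Equiv.Perm (Fin n)) : ℕ :=
  (Finset.univ.filter fun i : Fin n => 0 < (i : ℕ) ∧ i < σ i).card

/-- number of fixed points other than `1` -/
def fixHat {n : ℕ} (σ : Equiv.Perm (Fin n)) : ℕ :=
  (Finset.univ.filter fun i : Fin n => 0 < (i : ℕ) ∧ σ i = i).card

/-- number of cycles (orbits) of a permutation -/
def cyc {n : ℕ} (σ : Equiv.Perm (Fin n)) : ℕ :=
  σ.cycleType.card + fixStat σ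

/-- number of cycle double ascents: values `x` with `σ⁻¹(x) < x < σ(x)` -/
def cda {n : ℕ} (σ : Equiv.Perm (Fin n)) : ℕ :=
  (Finset.univ.filter fun x : Fin n => σ⁻¹ x < x ∧ x < σ x).card

open Classical in
/-- number of left-to-right minima -/
noncomputable def lrmin {n : ℕ} (π : Equiv.Perm (Fin n)) : ℕ :=
  ((Finset.Icc 1 n).filter fun i => ∀ j ∈ Finset.Icc 1 n, j < i → word π i < word π j).card

open Classical in
/-- number of proper left-to-right minima -/
noncomputable def plrmin {n : ℕ} (π : Equiv.Perm (Fin n)) : ℕ :=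
  ((Finset.Icc 1 n).filter fun i =>
    (∀ j ∈ Finset.Icc 1 n, j < i → word π i < word π j) ∧ word π i ≠ 1 ∧
      ∃ k ∈ Finset.Icc 1 n, i < k ∧ word π k = word π i - 1 ∧ word π (k + 1) < word π k).card

open Classical in
/-- number of simsun successions -/
noncomputable def simsuc {n : ℕ} (π : Equiv.Perm (Fin n)) : ℕ :=
  ((Finset.Icc 1 n).filter fun i =>
    ∃ j ∈ Finset.Icc 1 n, i < j ∧ word π j = word π i + 1 ∧
      ∀ k ∈ Finset.Icc 1 n, i < k → k < j → word π i + 1 < word π k).card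

/-- number of peaks (with the boundary conventions `π(0)=π(n+1)=0`) -/
def pk {n : ℕ} (π : Equiv.Perm (Fin n)) : ℕ :=
  ((Finset.Icc 1 n).filter fun i => word π (i - 1) < word π i ∧ word π (i + 1) < word π i).card

/-- number of valleys -/
def valStat {n : ℕ} (π : Equiv.Perm (Fin n)) : ℕ :=
  ((Finset.Icc 1 n).filter fun i => word π i < word π (i - 1) ∧ word π i < word π (i + 1)).card

/-- number of double ascents -/
def dasc {n : ℕ} (π : Equiv.Perm (Fin n)) : ℕ :=
  ((Finset.Icc 1 n).filter fun i => word π (i - 1) < word π i ∧ word π i < word π (i + 1)).card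

/-- number of double descents -/
def ddes {n : ℕ} (π : Equiv.Perm (Fin n)) : ℕ :=
  ((Finset.Icc 1 n).filter fun i => word π (i + 1) < word π i ∧ word π i < word π (i - 1)).card

open Classical in
/-- `nextVal σ m x` is the (0-indexed) first value `≤ m` (i.e. `< m` in 0-indexed terms)
in the forward orbit of `x` under `σ`: it equals `σ^t(x)` for the minimal `t ≥ 1`
with `σ^t(x) < m`, when such `t` exists. This is the action of the permutation `σ_k`
(with `m = n - k`) obtained by removing the `k` largest letters from the cycles of `σ`. -/
noncomputable def nextVal {n : ℕ} (σ : Equiv.Perm (Fin n)) (m : ℕ) (x : Fin n) : ℕ :=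
  if h : ∃ t : ℕ, 0 < t ∧ (((σ ^ t) x : Fin n) : ℕ) < m then (((σ ^ Nat.find h) x : Fin n) : ℕ)
  else 0

/-- `σ` is a simsun permutation of the second kind: for every `0 ≤ k ≤ n-1`, the
permutation of `[n-k]` obtained from `σ` by removing the `k` largest letters has
no cycle double ascents. (Here `m = n - k` and values are 0-indexed.) -/
def IsSimsun2 {n : ℕ} (σ : Equiv.Perm (Fin n)) : Prop :=
  ∀ m ≤ n, ∀ x : Fin n, (x : ℕ) < m →
    ¬ (nextVal σ⁻¹ m x < (x : ℕ) ∧ (x : ℕ) < nextVal σ m x)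

noncomputable instance {n : ℕ} : DecidablePred (IsSimsun2 (n := n)) :=
  fun _ => Classical.propDecidable _

/-- the derangement polynomial `d_n(x)` -/
def dpoly (n : ℕ) (x : ℝ) : ℝ :=
  ∑ σ ∈ Finset.univ.filter fun σ : Equiv.Perm (Fin n) => fixStat σ = 0, x ^ excStat σ

/-- the Eulerian polynomial `A_n(x)` -/
def eulerian (n : ℕ) (x : ℝ) : ℝ :=
  ∑ π : Equiv.Perm (Fin n), x ^ des π


/-! Helper material. -/

abbrev V3 := ℕ × ℕ × ℕ

def vX : V3 := (1, 0, 0)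
def vY : V3 := (0, 1, 0)
def vS : V3 := (0, 0, 1)

/-- classification of a pair -/
def cl (a b : ℕ) : V3 := if a < b then vX else if b = a then vS else vY

lemma cl_lt {a b : ℕ} (h : a < b) : cl a b = vX := by simp [cl, h]
lemma cl_eq (a : ℕ) : cl a a = vS := by simp [cl]
lemma cl_gt {a b : ℕ} (h : b < a) : cl a b = vY := by
  have h1 : ¬ a < b := by omega
  have h2 : b ≠ a := by omega
  simp [cl, h1, h2]

def TT (F : V3 → ℝ) (v t : V3) : ℝ := F (v + vX + vY - t)

lemma TT_Y (F : V3 → ℝ) (v : V3) : TT F v vY = F (v + vX) := by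
  simp [TT]

lemma TT_eq (F : V3 → ℝ) {v t u : V3} (h : u + t = v + vX + vY) : F u = TT F v t := by
  rw [TT, ← h]; simp

def RR (F : V3 → ℝ) (v : V3) : ℝ :=
  F (v + vS) + F (v + vY) + (v.1 * TT F v vX + v.2.1 * TT F v vY + v.2.2 * TT F v vS)

lemma sum_cl {ι : Type*} (I : Finset ι) (T : V3 → ℝ) (a b : ι → ℕ) :
    ∑ i ∈ I, T (cl (a i) (b i)) =
      ((∑ i ∈ I, cl (a i) (b i)).1 * T vX + (∑ i ∈ I, cl (a i) (b i)).2.1 * T vY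
        + (∑ i ∈ I, cl (a i) (b i)).2.2 * T vS) := by
  classical
  induction I using Finset.induction_on with
  | empty => simp
  | insert j I hj ih =>
    rw [Finset.sum_insert hj, Finset.sum_insert hj, ih]
    rcases lt_trichotomy (a j) (b j) with h | h | h
    · rw [cl_lt h]; simp [vX]; ring
    · rw [h, cl_eq]; simp [vS]; ring
    · rw [cl_gt h]; simp [vY]; ring

/-! The permutation side. -/

def pv {m : ℕ} (σ : Equiv.Perm (Fin (m + 1))) : V3 :=
  ∑ i : Fin m, cl (i.succ : Fin (m + 1)) (σ i.succ)

/-- insertion of a new largest value at position `p` (linear) -/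
def ins {n : ℕ} (q : Equiv.Perm (Fin n) × Fin (n + 1)) : Equiv.Perm (Fin (n + 1)) :=
  ((finSuccEquiv' q.2).trans (Equiv.optionCongr q.1)).trans finSuccEquivLast.symm

lemma ins_self {n : ℕ} (π : Equiv.Perm (Fin n)) (p : Fin (n + 1)) :
    ins (π, p) p = Fin.last n := by
  simp [ins]

lemma ins_succAbove {n : ℕ} (π : Equiv.Perm (Fin n)) (p : Fin (n + 1)) (i : Fin n) :
    ins (π, p) (p.succAbove i) = (π i).castSucc := by
  simp [ins]

lemma ins_inj {n : ℕ} : Function.Injective (ins (n := n)) := by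
  rintro ⟨π, p⟩ ⟨ρ, q⟩ h
  have hpq : p = q := by
    apply (ins (ρ, q)).injective
    rw [ins_self, ← h, ins_self]
  subst hpq
  have : π = ρ := by
    ext i
    have h1 := ins_succAbove π p i
    rw [h, ins_succAbove] at h1
    have := congrArg Fin.val h1
    simpa using this.symm
  rw [this]

lemma ins_bij {n : ℕ} : Function.Bijective (ins (n := n)) := by
  rw [Fintype.bijective_iff_injective_and_card]
  refine ⟨ins_inj, ?_⟩
  simp [Fintype.card_perm, Nat.factorial_succ, mul_comm]

/-- insertion of a new largest value into a cycle -/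
def cins {n : ℕ} (q : Equiv.Perm (Fin n) × Fin (n + 1)) : Equiv.Perm (Fin (n + 1)) :=
  (Equiv.swap q.2 (Fin.last n)).trans (ins (q.1, Fin.last n))

lemma ext_castSucc {n : ℕ} (π : Equiv.Perm (Fin n)) (i : Fin n) :
    ins (π, Fin.last n) i.castSucc = (π i).castSucc := by
  have := ins_succAbove π (Fin.last n) i
  rwa [Fin.succAbove_last] at this

lemma cins_inj {n : ℕ} : Function.Injective (cins (n := n)) := by
  rintro ⟨π, p⟩ ⟨ρ, q⟩ h
  have hpq : p = q := by
    apply (cins (ρ, q)).injective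
    rw [← h]
    have e1 : cins (π, p) p = Fin.last n := by simp [cins, ins_self]
    have e2 : cins (ρ, q) q = Fin.last n := by simp [cins, ins_self]
    rw [e1, h, e2]
  subst hpq
  have h2 : ins (π, Fin.last n) = ins (ρ, Fin.last n) := by
    ext i
    have := congrArg (fun e => e (Equiv.swap p (Fin.last n) i)) h
    simp [cins] at this
    rw [this]
  have := ins_inj h2
  simp at this
  rw [this]

lemma cins_bij {n : ℕ} : Function.Bijective (cins (n := n)) := by
  rw [Fintype.bijective_iff_injective_and_card]
  refine ⟨cins_inj, ?_⟩
  simp [Fintype.card_perm, Nat.factorial_succ, mul_comm]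

lemma pv_last {m : ℕ} (τ : Equiv.Perm (Fin (m + 1))) :
    pv (cins (τ, Fin.last (m + 1))) = pv τ + vS := by
  have e1 : cins (τ, Fin.last (m + 1)) = ins (τ, Fin.last (m + 1)) := by
    simp [cins]
  rw [pv, Fin.sum_univ_castSucc, e1, pv, Fin.succ_last, ins_self, cl_eq]
  congr 1
  apply Finset.sum_congr rfl
  intro i _
  rw [Fin.succ_castSucc, ext_castSucc]; simp

lemma cins_castSucc_self {n : ℕ} (τ : Equiv.Perm (Fin n)) (k : Fin n) :
    cins (τ, k.castSucc) k.castSucc = Fin.last n := by simp [cins, ins_self]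

lemma cins_castSucc_last {n : ℕ} (τ : Equiv.Perm (Fin n)) (k : Fin n) :
    cins (τ, k.castSucc) (Fin.last n) = (τ k).castSucc := by simp [cins, ext_castSucc]

lemma cins_castSucc_ne {n : ℕ} (τ : Equiv.Perm (Fin n)) (k j : Fin n) (h : j ≠ k) :
    cins (τ, k.castSucc) j.castSucc = (τ j).castSucc := by
  have : Equiv.swap k.castSucc (Fin.last n) j.castSucc = j.castSucc := by
    apply Equiv.swap_apply_of_ne_of_ne
    · simpa using h
    · exact (Fin.castSucc_lt_last j).ne
  simp [cins, this, ext_castSucc]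

lemma pv_zero {m : ℕ} (τ : Equiv.Perm (Fin (m + 1))) :
    pv (cins (τ, (0 : Fin (m + 1)).castSucc)) = pv τ + vY := by
  rw [pv, Fin.sum_univ_castSucc, pv, Fin.succ_last, cins_castSucc_last]
  congr 1
  · apply Finset.sum_congr rfl
    intro i _
    rw [Fin.succ_castSucc, cins_castSucc_ne _ _ _ (Fin.succ_ne_zero i)]; simp
  · apply cl_gt; simp; omega

lemma pv_succ {m : ℕ} (τ : Equiv.Perm (Fin (m + 1))) (k : Fin m) :
    pv (cins (τ, k.succ.castSucc)) + cl (k.succ : Fin (m + 1)) (τ k.succ) = pv τ + vX + vY := by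
  rw [pv, Fin.sum_univ_castSucc, pv, Fin.succ_last, cins_castSucc_last]
  have e : cl (Fin.last (m + 1)) (τ k.succ).castSucc = vY := by
    apply cl_gt; simp; omega
  rw [e, ← Finset.add_sum_erase _ _ (Finset.mem_univ k),
    ← Finset.add_sum_erase (Finset.univ : Finset (Fin m)) (fun i => cl (i.succ : Fin (m+1)) (τ i.succ)) (Finset.mem_univ k)]
  have e2 : cl (k.castSucc.succ : Fin (m + 2)) (cins (τ, k.succ.castSucc) k.castSucc.succ) = vX := by
    rw [Fin.succ_castSucc, cins_castSucc_self]
    apply cl_lt; simp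
  rw [e2]
  have e3 : ∑ x ∈ Finset.univ.erase k, cl (x.castSucc.succ : Fin (m + 2)) (cins (τ, k.succ.castSucc) x.castSucc.succ)
     = ∑ x ∈ Finset.univ.erase k, cl (x.succ : Fin (m + 1)) (τ x.succ) := by
    apply Finset.sum_congr rfl
    intro i hi
    rw [Fin.succ_castSucc, cins_castSucc_ne]
    · simp
    · simpa using Finset.ne_of_mem_erase hi
  rw [e3]
  abel

lemma perm_rec (m : ℕ) (F : V3 → ℝ) :
    ∑ σ : Equiv.Perm (Fin (m + 2)), F (pv σ) = ∑ τ : Equiv.Perm (Fin (m + 1)), RR F (pv τ) := by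
  rw [← Function.Bijective.sum_comp cins_bij (fun σ => F (pv σ)), Fintype.sum_prod_type]
  apply Finset.sum_congr rfl
  intro τ _
  rw [Fin.sum_univ_castSucc, pv_last, Fin.sum_univ_succ, pv_zero, RR]
  have : ∑ i : Fin m, F (pv (cins (τ, i.succ.castSucc))) =
      ∑ i : Fin m, TT F (pv τ) (cl (i.succ : Fin (m + 1)) (τ i.succ)) :=
    Finset.sum_congr rfl fun i _ => TT_eq F (pv_succ τ i)
  rw [this, sum_cl]
  simp only [pv]
  ring

/-! The word side. -/

def W {n : ℕ} (π : Equiv.Perm (Fin n)) (j : ℕ) : ℕ := if h : j < n then (π ⟨j, h⟩ : ℕ) else 0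

def wv {m : ℕ} (π : Equiv.Perm (Fin (m + 1))) : V3 :=
  ∑ j ∈ Finset.range m, cl (W π j + 1) (W π (j + 1))

lemma W_ins_lt {n : ℕ} (π : Equiv.Perm (Fin n)) (p : Fin (n + 1)) (j : ℕ) (h : j < p) :
    W (ins (π, p)) j = W π j := by
  have hj : j < n := by omega
  have := ins_succAbove π p ⟨j, hj⟩
  rw [Fin.succAbove_of_castSucc_lt _ _ (by simpa [Fin.lt_def] using h)] at this
  have h2 := congrArg Fin.val this
  simp only [W, hj, show j < n + 1 by omega, dif_pos]
  simpa using h2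

lemma W_ins_self {n : ℕ} (π : Equiv.Perm (Fin n)) (p : Fin (n + 1)) :
    W (ins (π, p)) p = n := by
  have := p.2
  simp only [W, this, dif_pos, Fin.eta, ins_self, Fin.val_last]

lemma W_ins_gt {n : ℕ} (π : Equiv.Perm (Fin n)) (p : Fin (n + 1)) (j : ℕ) (h : p ≤ j) (hj : j < n) :
    W (ins (π, p)) (j + 1) = W π j := by
  have := ins_succAbove π p ⟨j, hj⟩
  rw [Fin.succAbove_of_le_castSucc _ _ (by simpa [Fin.le_def] using h)] at this
  have h2 := congrArg Fin.val this
  simp only [W, hj, show j + 1 < n + 1 by omega, dif_pos]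
  simpa using h2

lemma W_lt {n : ℕ} (π : Equiv.Perm (Fin n)) (j : ℕ) (h : j < n) : W π j < n := by
  simp [W, h]

lemma W_inj {n : ℕ} (π : Equiv.Perm (Fin n)) {i j : ℕ} (hi : i < n) (hj : j < n)
    (h : W π i = W π j) : i = j := by
  simp only [W, hi, hj, dif_pos] at h
  have := π.injective (Fin.ext h)
  simpa using this

lemma wv_zero {m : ℕ} (π : Equiv.Perm (Fin (m + 1))) : wv (ins (π, 0)) = wv π + vY := by
  rw [wv, Finset.sum_range_succ', wv]
  congr 1
  · apply Finset.sum_congr rfl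
    intro j hj
    have := Finset.mem_range.1 hj
    rw [W_ins_gt _ _ _ (by simp) (by omega), W_ins_gt _ _ _ (by simp) (by omega)]
  · rw [W_ins_gt _ _ _ (by simp) (by omega)]
    have := W_ins_self π 0
    simp only [Fin.val_zero] at this
    rw [this]
    apply cl_gt
    have := W_lt π 0 (by omega)
    omega

lemma wv_last {m : ℕ} (π : Equiv.Perm (Fin (m + 1))) :
    wv (ins (π, Fin.last (m + 1))) = wv π + cl (W π m + 1) (m + 1) := by
  rw [wv, Finset.sum_range_succ, wv]
  have := W_ins_self π (Fin.last (m + 1))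
  simp only [Fin.val_last] at this
  rw [this, W_ins_lt _ _ _ (by simp)]
  congr 1
  apply Finset.sum_congr rfl
  intro j hj
  have := Finset.mem_range.1 hj
  rw [W_ins_lt _ _ _ (by simp; omega), W_ins_lt _ _ _ (by simp; omega)]

lemma seq_mid (g : ℕ → ℕ → V3) (w w' : ℕ → ℕ) (M k m : ℕ) (hk : k < m)
    (h1 : ∀ j ≤ k, w' j = w j) (h2 : w' (k + 1) = M)
    (h3 : ∀ j, k + 1 ≤ j → j ≤ m → w' (j + 1) = w j) :
    ∑ j ∈ Finset.range (m + 1), g (w' j) (w' (j + 1)) + g (w k) (w (k + 1)) =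
      ∑ j ∈ Finset.range m, g (w j) (w (j + 1)) + g (w k) M + g M (w (k + 1)) := by
  induction m, hk using Nat.le_induction with
  | base =>
    rw [Finset.sum_range_succ, Finset.sum_range_succ, Finset.sum_range_succ, h2, h1 k le_rfl,
      h3 (k + 1) le_rfl le_rfl]
    have : ∑ j ∈ Finset.range k, g (w' j) (w' (j + 1)) = ∑ j ∈ Finset.range k, g (w j) (w (j + 1)) := by
      apply Finset.sum_congr rfl
      intro j hj
      have := Finset.mem_range.1 hj
      rw [h1 j (by omega), h1 (j + 1) (by omega)]
    rw [this]; abel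
  | succ m hm ih =>
    have hm' : k + 1 ≤ m := hm
    rw [Finset.sum_range_succ _ (m + 1), Finset.sum_range_succ (fun j => g (w j) (w (j + 1))) m, h3 m (by omega) (by omega),
      h3 (m + 1) (by omega) le_rfl]
    have := ih (fun j a b => h3 j a (by omega))
    calc _ = (∑ j ∈ Finset.range (m + 1), g (w' j) (w' (j + 1)) + g (w k) (w (k + 1)))
          + g (w m) (w (m + 1)) := by abel
      _ = _ := by rw [this]; abel

lemma wv_mid {m : ℕ} (π : Equiv.Perm (Fin (m + 1))) (k : ℕ) (hk : k < m) :
    wv (ins (π, ⟨k + 1, by omega⟩)) + cl (W π k + 1) (W π (k + 1)) =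
      wv π + cl (W π k + 1) (m + 1) + vY := by
  have e : cl (m + 1 + 1) (W π (k + 1)) = vY := by
    apply cl_gt
    have := W_lt π (k + 1) (by omega)
    omega
  rw [← e]
  apply seq_mid (fun a b => cl (a + 1) b) (W π) _ (m + 1) k m hk
  · intro j hj
    exact W_ins_lt _ _ _ (by simp; omega)
  · exact W_ins_self π ⟨k + 1, by omega⟩
  · intro j h1 h2
    exact W_ins_gt _ _ _ (by simpa using h1) (by omega)

lemma word_rec (m : ℕ) (F : V3 → ℝ) :
    ∑ σ : Equiv.Perm (Fin (m + 2)), F (wv σ) = ∑ τ : Equiv.Perm (Fin (m + 1)), RR F (wv τ) := by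
  rw [← Function.Bijective.sum_comp ins_bij (fun σ => F (wv σ)), Fintype.sum_prod_type]
  apply Finset.sum_congr rfl
  intro π _
  rw [Fin.sum_univ_succ, wv_zero, Fin.sum_univ_castSucc, Fin.succ_last, wv_last]
  set t : ℕ → ℝ := fun k => TT F (wv π) (cl (W π k + 1) (W π (k + 1))) with ht
  set f : ℕ → ℝ := fun k => if h : k < m then F (wv (ins (π, ⟨k + 1, by omega⟩))) else 0 with hf
  have e1 : ∑ i : Fin m, F (wv (ins (π, i.castSucc.succ))) = ∑ k ∈ Finset.range m, f k := by
    rw [← Fin.sum_univ_eq_sum_range]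
    apply Finset.sum_congr rfl
    intro i _
    simp only [hf, i.2, dif_pos]
    rfl
  have gen : ∀ k, k < m → W π k ≠ m → f k = t k := by
    intro k hk hne
    simp only [hf, hk, dif_pos]
    apply TT_eq
    rw [wv_mid π k hk, cl_lt]
    have := W_lt π k (by omega)
    omega
  have spec : ∀ k, k < m → W π k = m → f k = F (wv π + vS) ∧ t k = F (wv π + vX) := by
    intro k hk he
    have hY : cl (W π k + 1) (W π (k + 1)) = vY := by
      apply cl_gt
      have := W_lt π (k + 1) (by omega)
      omega
    constructor
    · have h := wv_mid π k hk
      rw [hY, he, cl_eq] at h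
      simp only [hf, hk, dif_pos]
      rw [add_right_cancel h]
    · simp only [ht, hY, TT_Y]
  have key : ∑ k ∈ Finset.range m, f k + F (wv π + cl (W π m + 1) (m + 1)) =
      ∑ k ∈ Finset.range m, t k + F (wv π + vS) := by
    by_cases hm : W π m = m
    · rw [hm, cl_eq]
      congr 1
      apply Finset.sum_congr rfl
      intro k hk
      have hk := Finset.mem_range.1 hk
      apply gen k hk
      intro h
      have := W_inj π (i := k) (j := m) (by omega) (by omega) (by omega)
      omega
    · have hX : cl (W π m + 1) (m + 1) = vX := by
        apply cl_lt
        have := W_lt π m (by omega)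
        omega
      obtain ⟨⟨k, hk1⟩, hk⟩ := π.surjective (Fin.last m)
      have hWk : W π k = m := by simp [W, hk1, hk]
      have hkm : k < m := by
        rcases Nat.lt_or_ge k m with h | h
        · exact h
        · exfalso; apply hm; have hh : k = m := by omega
          rw [hh] at hWk; exact hWk
      have hmem := Finset.mem_range.2 hkm
      obtain ⟨s1, s2⟩ := spec k hkm hWk
      rw [hX, ← Finset.add_sum_erase _ _ hmem, ← Finset.add_sum_erase _ t hmem, s1, s2]
      have : ∑ j ∈ (Finset.range m).erase k, f j = ∑ j ∈ (Finset.range m).erase k, t j := by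
        apply Finset.sum_congr rfl
        intro j hj
        have hj1 := Finset.mem_range.1 (Finset.mem_of_mem_erase hj)
        apply gen j hj1
        intro h
        exact Finset.ne_of_mem_erase hj (W_inj π (by omega) (by omega) (by omega))
      rw [this]; ring
  rw [e1, key, RR]
  simp only [ht]
  rw [sum_cl]
  simp only [wv]
  ring

lemma main_eq (m : ℕ) : ∀ F : V3 → ℝ,
    ∑ π : Equiv.Perm (Fin (m + 1)), F (wv π) = ∑ π : Equiv.Perm (Fin (m + 1)), F (pv π) := by
  induction m with
  | zero => intro F; simp [wv, pv]
  | succ m ih => intro F; rw [word_rec, perm_rec, ih]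

lemma word_W {n : ℕ} (π : Equiv.Perm (Fin n)) (j : ℕ) (h : j < n) : word π (j + 1) = W π j + 1 := by
  have : 1 ≤ j + 1 ∧ j + 1 ≤ n := by omega
  simp [word, W, h, this]

lemma card_Icc_range (m : ℕ) (P : ℕ → Prop) [DecidablePred P] :
    ((Finset.Icc 1 m).filter P).card = ∑ j ∈ Finset.range m, if P (j + 1) then 1 else 0 := by
  rw [Finset.card_filter, Finset.range_eq_Ico, Finset.sum_Ico_add' (fun j => if P j then 1 else 0) 0 m 1]
  rfl

lemma wv_stats {m : ℕ} (π : Equiv.Perm (Fin (m + 1))) : wv π = (basc π, des π, suc π) := by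
  have hne : ∀ j < m, W π (j + 1) ≠ W π j := fun j hj h => by
    have := W_inj π (by omega) (by omega) h
    omega
  refine Prod.ext ?_ (Prod.ext ?_ ?_)
  · simp only [basc, card_Icc_range, wv, Prod.fst_sum, Nat.add_sub_cancel]
    apply Finset.sum_congr rfl
    intro j hj
    have hj := Finset.mem_range.1 hj
    rw [word_W _ _ (by omega), word_W _ _ (by omega)]
    have := hne j hj
    unfold cl vX vY vS
    split_ifs <;> first | rfl | omega
  · simp only [des, card_Icc_range, wv, Prod.fst_sum, Prod.snd_sum, Nat.add_sub_cancel]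
    apply Finset.sum_congr rfl
    intro j hj
    have hj := Finset.mem_range.1 hj
    rw [word_W _ _ (by omega), word_W _ _ (by omega)]
    have := hne j hj
    unfold cl vX vY vS
    split_ifs <;> first | rfl | omega
  · simp only [suc, card_Icc_range, wv, Prod.snd_sum, Nat.add_sub_cancel]
    apply Finset.sum_congr rfl
    intro j hj
    have hj := Finset.mem_range.1 hj
    rw [word_W _ _ (by omega), word_W _ _ (by omega)]
    have := hne j hj
    unfold cl vX vY vS
    split_ifs <;> first | rfl | omega

lemma pv_stats {m : ℕ} (σ : Equiv.Perm (Fin (m + 1))) :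
    pv σ = (excHat σ, dropStat σ, fixHat σ) := by
  refine Prod.ext ?_ (Prod.ext ?_ ?_)
  · simp only [excHat, Finset.card_filter, pv, Prod.fst_sum, Fin.sum_univ_succ]
    simp only [Fin.val_zero, lt_irrefl, false_and, if_false, zero_add]
    apply Finset.sum_congr rfl
    intro j _
    simp only [Fin.lt_def, Fin.ext_iff, Fin.val_succ]
    unfold cl vX vY vS
    split_ifs <;> first | rfl | omega
  · simp only [dropStat, Finset.card_filter, pv, Prod.fst_sum, Prod.snd_sum, Fin.sum_univ_succ]
    simp only [Fin.not_lt_zero, if_false, zero_add]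
    apply Finset.sum_congr rfl
    intro j _
    simp only [Fin.lt_def, Fin.ext_iff, Fin.val_succ]
    unfold cl vX vY vS
    split_ifs <;> first | rfl | omega
  · simp only [fixHat, Finset.card_filter, pv, Prod.snd_sum, Fin.sum_univ_succ]
    simp only [Fin.val_zero, lt_irrefl, false_and, if_false, zero_add]
    apply Finset.sum_congr rfl
    intro j _
    simp only [Fin.ext_iff, Fin.val_succ]
    unfold cl vX vY vS
    split_ifs <;> first | rfl | omega

/-- for every `n ≥ 1` and all real `x, y, s`,
`Σ_{π ∈ S_n} x^basc(π) y^des(π) s^suc(π) = Σ_{π ∈ S_n} x^êxc(π) y^drop(π) s^f̂ix(π)`. -/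
theorem statement0 (n : ℕ) (hn : 1 ≤ n) (x y s : ℝ) :
    ∑ π : Equiv.Perm (Fin n), x ^ basc π * y ^ des π * s ^ suc π =
      ∑ π : Equiv.Perm (Fin n), x ^ excHat π * y ^ dropStat π * s ^ fixHat π := by
  obtain ⟨m, rfl⟩ : ∃ m, n = m + 1 := ⟨n - 1, by omega⟩
  have := main_eq m (fun v => x ^ v.1 * y ^ v.2.1 * s ^ v.2.2)
  simpa only [wv_stats, pv_stats] using this

end SucEuler
end

section
/- For every n ≥ 1 and all subsets X, Y, Z of [n]: the number of permutations π ∈ S_n with bASC(π)=X, Des(π)=Y and Suc(π)=Z equals the number of permutations π ∈ S_n with Êxc(π)=X, Drop(π)=Y and F̂ix(π)=Z. That is, the triple set-valued statistics (bASC, Des, Suc) and (Êxc, Drop, F̂ix) are equidistributed over S_n. -/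
open Finset

namespace SucEuler

/-- set of big ascent tops `{π(i+1) : π(i+1) ≥ π(i)+2}` -/
def bASCSet {n : ℕ} (π : Equiv.Perm (Fin n)) : Finset ℕ :=
  ((Finset.Icc 1 (n - 1)).filter fun i => word π i + 2 ≤ word π (i + 1)).image
    fun i => word π (i + 1)

/-- set of descent bottoms `{π(i+1) : π(i) > π(i+1)}` -/
def desSet {n : ℕ} (π : Equiv.Perm (Fin n)) : Finset ℕ :=
  ((Finset.Icc 1 (n - 1)).filter fun i => word π (i + 1) < word π i).image
    fun i => word π (i + 1)

/-- set of succession tops `{π(i+1) : π(i+1) = π(i)+1}` -/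
def sucSet {n : ℕ} (π : Equiv.Perm (Fin n)) : Finset ℕ :=
  ((Finset.Icc 1 (n - 1)).filter fun i => word π (i + 1) = word π i + 1).image
    fun i => word π (i + 1)

/-- set of excedance values at positions `2 ≤ i ≤ n` -/
def excHatSet {n : ℕ} (π : Equiv.Perm (Fin n)) : Finset ℕ :=
  ((Finset.Icc 2 n).filter fun i => i < word π i).image (word π)

/-- set of drop values at positions `2 ≤ i ≤ n` -/
def dropSet {n : ℕ} (π : Equiv.Perm (Fin n)) : Finset ℕ :=
  ((Finset.Icc 2 n).filter fun i => word π i < i).image (word π)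

/-- set of fixed points `2 ≤ i ≤ n` -/
def fixHatSet {n : ℕ} (π : Equiv.Perm (Fin n)) : Finset ℕ :=
  (Finset.Icc 2 n).filter fun i => word π i = i

def cls (q v : ℕ) : Fin 4 := if q = 0 then 0 else if q < v then 1 else if v < q then 2 else 3

def statC {n : ℕ} (σ : Equiv.Perm (Fin n)) (v : Fin n) : Fin 4 := cls (σ.symm v) v

def statW {n : ℕ} (π : Equiv.Perm (Fin n)) (v : Fin n) : Fin 4 :=
  cls (if (π.symm v).val = 0 then 0 else (π ⟨(π.symm v).val - 1, by omega⟩).val + 1) v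

theorem statC_apply {n : ℕ} (σ : Equiv.Perm (Fin n)) (i : Fin n) :
    statC σ (σ i) = cls i (σ i) := by simp [statC]

theorem statW_zero {n : ℕ} (π : Equiv.Perm (Fin n)) (i : Fin n) (h : i.val = 0) :
    statW π (π i) = 0 := by simp [statW, h, cls]

theorem statW_succ {n : ℕ} (π : Equiv.Perm (Fin n)) (i j : Fin n) (h : j.val = i.val + 1) :
    statW π (π j) = cls ((π i).val + 1) (π j) := by
  have : (⟨j.val - 1, by omega⟩ : Fin n) = i := Fin.ext (by simp only []; omega)
  simp [statW, h]

def insW {n : ℕ} (π : Equiv.Perm (Fin n)) (j : Fin (n + 1)) : Equiv.Perm (Fin (n + 1)) :=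
  (finSuccEquiv' j).trans ((Equiv.optionCongr π).trans (finSuccEquiv' (Fin.last n)).symm)

theorem insW_self {n : ℕ} (π : Equiv.Perm (Fin n)) (j : Fin (n + 1)) :
    insW π j j = Fin.last n := by simp [insW]

theorem insW_succAbove {n : ℕ} (π : Equiv.Perm (Fin n)) (j : Fin (n + 1)) (k : Fin n) :
    insW π j (j.succAbove k) = Fin.castSucc (π k) := by simp [insW]

theorem insW_last {n : ℕ} (π : Equiv.Perm (Fin n)) (k : Fin n) :
    insW π (Fin.last n) (Fin.castSucc k) = Fin.castSucc (π k) := by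
  rw [← insW_succAbove π (Fin.last n) k, Fin.succAbove_last]

def insC {n : ℕ} (σ : Equiv.Perm (Fin n)) (v : Fin (n + 1)) : Equiv.Perm (Fin (n + 1)) :=
  (insW σ (Fin.last n)).trans (Equiv.swap v (Fin.last n))

theorem insC_last {n : ℕ} (σ : Equiv.Perm (Fin n)) (v : Fin (n + 1)) :
    insC σ v (Fin.last n) = v := by simp [insC, insW_self]

theorem insC_castSucc {n : ℕ} (σ : Equiv.Perm (Fin n)) (v : Fin (n + 1)) (k : Fin n) :
    insC σ v (Fin.castSucc k) =
      if v = Fin.castSucc (σ k) then Fin.last n else Fin.castSucc (σ k) := by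
  simp only [insC, Equiv.trans_apply, insW_last]
  split_ifs with h
  · rw [h, Equiv.swap_apply_left]
  · exact Equiv.swap_apply_of_ne_of_ne (Ne.symm h) (Fin.castSucc_ne_last _)

theorem card_aux (n : ℕ) : Fintype.card (Equiv.Perm (Fin n) × Fin (n + 1)) =
    Fintype.card (Equiv.Perm (Fin (n + 1))) := by
  simp [Fintype.card_perm, Nat.factorial_succ, mul_comm]

theorem insW_bij (n : ℕ) : Function.Bijective
    (fun p : Equiv.Perm (Fin n) × Fin (n + 1) => insW p.1 p.2) := by
  rw [Fintype.bijective_iff_injective_and_card]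
  refine ⟨?_, card_aux n⟩
  rintro ⟨π, j⟩ ⟨π', j'⟩ h
  simp only at h
  have hj : j = j' := by
    apply (insW π' j').injective
    rw [insW_self, ← h, insW_self]
  subst hj
  have : π = π' := by
    ext k
    have := congrArg (fun e : Equiv.Perm (Fin (n + 1)) => e (j.succAbove k)) h
    simp only [insW_succAbove] at this
    simpa using congrArg Fin.val this
  rw [this]

theorem insC_bij (n : ℕ) : Function.Bijective
    (fun p : Equiv.Perm (Fin n) × Fin (n + 1) => insC p.1 p.2) := by
  rw [Fintype.bijective_iff_injective_and_card]
  refine ⟨?_, card_aux n⟩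
  rintro ⟨π, j⟩ ⟨π', j'⟩ h
  simp only at h
  have hj : j = j' := by
    rw [← insC_last π j, h, insC_last]
  subst hj
  have h2 : insW π (Fin.last n) = insW π' (Fin.last n) := by
    ext x
    have := congrArg (fun e : Equiv.Perm (Fin (n + 1)) => e x) h
    simp only [insC, Equiv.trans_apply, EmbeddingLike.apply_eq_iff_eq] at this
    rw [this]
  have := (insW_bij n).1 (a₁ := (π, Fin.last n)) (a₂ := (π', Fin.last n)) h2
  simp only [Prod.mk.injEq, and_true] at this
  rw [this]

open Classical in
noncomputable def child {n : ℕ} (T : Fin n → Fin 4) (v : Fin (n + 1)) : Fin (n + 1) → Fin 4 :=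
  Fin.lastCases (motive := fun _ => Fin 4)
    (if v = Fin.last n then 3 else if ∃ k, v = Fin.castSucc k ∧ T k = 0 then 0 else 1)
    (fun k => if v = Fin.castSucc k then 2 else T k)

theorem eq_child {n : ℕ} (T : Fin n → Fin 4) (v : Fin (n + 1)) (U : Fin (n + 1) → Fin 4)
    (h1 : v = Fin.last n → U (Fin.last n) = 3)
    (h2 : ∀ k, v = Fin.castSucc k → U (Fin.last n) = if T k = 0 then 0 else 1)
    (h3 : ∀ k, U (Fin.castSucc k) = if v = Fin.castSucc k then 2 else T k) : U = child T v := by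
  funext x
  induction x using Fin.lastCases with
  | cast k => simp [child, h3]
  | last =>
    simp only [child, Fin.lastCases_last]
    induction v using Fin.lastCases with
    | last => simp [h1]
    | cast k =>
      rw [h2 k rfl]
      simp [Fin.castSucc_ne_last]

theorem statC_insC {n : ℕ} (hn : n ≠ 0) (σ : Equiv.Perm (Fin n)) (v : Fin (n + 1)) :
    statC (insC σ v) = child (statC σ) v := by
  apply eq_child
  · rintro rfl
    have := statC_apply (insC σ (Fin.last n)) (Fin.last n)
    rw [insC_last] at this
    rw [this]
    simp [cls, hn]
  · rintro k rfl
    obtain ⟨i, rfl⟩ := σ.surjective k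
    have := statC_apply (insC σ (Fin.castSucc (σ i))) (Fin.castSucc i)
    rw [insC_castSucc, if_pos rfl] at this
    rw [this, statC_apply]
    simp only [cls, Fin.val_castSucc, Fin.val_last]
    split_ifs <;> first | rfl | omega | contradiction | (exfalso; omega) | simp_all
  · intro k
    obtain ⟨i, rfl⟩ := σ.surjective k
    split_ifs with h
    · have := statC_apply (insC σ v) (Fin.last n)
      rw [insC_last, h] at this
      rw [h, this]
      simp only [cls, Fin.val_castSucc, Fin.val_last]
      split_ifs <;> first | rfl | omega | contradiction | (exfalso; omega)
    · have := statC_apply (insC σ v) (Fin.castSucc i)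
      rw [insC_castSucc, if_neg h] at this
      rw [this, statC_apply]
      simp

def gmap {m : ℕ} (π : Equiv.Perm (Fin (m + 1))) : Equiv.Perm (Fin (m + 2)) :=
  (Equiv.swap (π.symm (Fin.last m)).succ (Fin.last (m + 1))).trans (insW π (Fin.last (m + 1)))

theorem statW_insW_last {m : ℕ} (π : Equiv.Perm (Fin (m + 1))) (j : Fin (m + 2)) :
    statW (insW π j) (Fin.last (m + 1)) =
      if j.val = 0 then 0 else if j = (π.symm (Fin.last m)).succ then 3 else 1 := by
  rw [← insW_self π j]
  split_ifs with h h2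
  · exact statW_zero _ _ h
  · have e : j.succAbove (π.symm (Fin.last m)) = (π.symm (Fin.last m)).castSucc := by
      apply Fin.succAbove_of_castSucc_lt; rw [h2]; exact Fin.castSucc_lt_succ
    rw [statW_succ _ (j.succAbove (π.symm (Fin.last m))) j (by rw [e, h2]; simp),
      insW_succAbove, insW_self]
    simp [cls]
  · have e : j.succAbove ⟨j.val - 1, by omega⟩ = (⟨j.val - 1, by omega⟩ : Fin (m+1)).castSucc := by
      apply Fin.succAbove_of_castSucc_lt; rw [Fin.lt_def]; simp only [Fin.val_castSucc]; omega
    rw [statW_succ _ (j.succAbove ⟨j.val - 1, by omega⟩) j (by rw [e]; simp; omega),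
      insW_succAbove, insW_self]
    have : (π ⟨j.val - 1, by omega⟩).val ≠ m := by
      intro h3
      apply h2
      have : π ⟨j.val - 1, by omega⟩ = Fin.last m := by ext; simpa using h3
      rw [← this]
      ext; simp; omega
    simp only [cls, Fin.val_castSucc, Fin.val_last]
    split_ifs <;> first | rfl | omega | contradiction | (exfalso; omega)

theorem statW_insW_cast {m : ℕ} (π : Equiv.Perm (Fin (m + 1))) (j : Fin (m + 2))
    (k : Fin (m + 1)) :
    statW (insW π j) (Fin.castSucc (π k)) = if j = Fin.castSucc k then 2 else statW π (π k) := by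
  rw [← insW_succAbove π j]
  split_ifs with h
  · have e : j.succAbove k = k.succ := by
      apply Fin.succAbove_of_le_castSucc; rw [h]
    rw [statW_succ _ j (j.succAbove k) (by rw [e, h]; simp), insW_succAbove, insW_self]
    simp only [cls, Fin.val_castSucc, Fin.val_last]
    split_ifs <;> first | rfl | omega | contradiction | (exfalso; omega)
  · have hv : ∀ k : Fin (m + 1),
        (j.succAbove k).val = if k.val < j.val then k.val else k.val + 1 := by
      intro k; simp only [Fin.succAbove, Fin.lt_def]; split_ifs <;> simp_all
    have hne : j.val ≠ k.val := fun h' => h (Fin.ext h')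
    by_cases hk : k.val = 0
    · rw [statW_zero π k hk, statW_zero]
      rw [hv, if_pos (by omega)]; exact hk
    · rw [statW_succ π ⟨k.val - 1, by omega⟩ k (by simp; omega),
        statW_succ _ (j.succAbove ⟨k.val - 1, by omega⟩) (j.succAbove k),
        insW_succAbove, insW_succAbove]
      · simp
      · rw [hv, hv]; simp only; split_ifs <;> omega

theorem statW_eq_zero {n : ℕ} (π : Equiv.Perm (Fin n)) (k : Fin n) :
    statW π (π k) = 0 ↔ k.val = 0 := by
  constructor
  · intro h
    by_contra hk
    rw [statW_succ π ⟨k.val - 1, by omega⟩ k (by simp; omega)] at h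
    revert h
    simp only [cls]
    split_ifs <;> simp_all
  · exact statW_zero π k

theorem statW_after {m : ℕ} (π : Equiv.Perm (Fin (m + 1))) (k : Fin (m + 1))
    (h : Fin.castSucc k = (π.symm (Fin.last m)).succ) : statW π (π k) = 2 := by
  have h' := congrArg Fin.val h
  simp only [Fin.val_castSucc, Fin.val_succ] at h'
  rw [statW_succ π (π.symm (Fin.last m)) k h']
  have : (π k).val ≠ m := by
    intro h3
    have : π k = Fin.last m := by ext; simpa using h3
    rw [← this] at h'
    simp at h'
  simp only [cls, Equiv.apply_symm_apply, Fin.val_last]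
  split_ifs <;> first | rfl | omega | contradiction | (exfalso; omega)

theorem statW_insW {m : ℕ} (π : Equiv.Perm (Fin (m + 1))) (j : Fin (m + 2)) :
    statW (insW π j) = child (statW π) (gmap π j) := by
  have hj0 : (π.symm (Fin.last m)).succ.val ≠ 0 := by simp
  by_cases hj : j = (π.symm (Fin.last m)).succ
  · have hg : gmap π j = Fin.last (m + 1) := by
      rw [hj]; simp [gmap, insW_self]
    rw [hg]
    apply eq_child
    · intro _
      rw [statW_insW_last, if_neg (by rw [hj]; exact hj0), if_pos hj]
    · intro k hk; exact absurd hk.symm (Fin.castSucc_ne_last _)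
    · intro k
      obtain ⟨i, rfl⟩ := π.surjective k
      rw [if_neg (Fin.castSucc_ne_last _).symm, statW_insW_cast]
      split_ifs with h
      · exact (statW_after π i (h ▸ hj)).symm
      · rfl
  · obtain ⟨i, hi⟩ | hl : (∃ i, j = Fin.castSucc i) ∨ j = Fin.last (m + 1) := by
      induction j using Fin.lastCases with
      | last => exact Or.inr rfl
      | cast i => exact Or.inl ⟨i, rfl⟩
    · have hg : gmap π j = Fin.castSucc (π i) := by
        rw [gmap, Equiv.trans_apply, Equiv.swap_apply_of_ne_of_ne hj
          (by rw [hi]; exact Fin.castSucc_ne_last _), hi, insW_last]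
      rw [hg]
      apply eq_child
      · intro h; exact absurd h (Fin.castSucc_ne_last _)
      · intro k hk
        rw [← Fin.castSucc_injective _ hk, statW_insW_last, if_neg hj]
        simp only [statW_eq_zero, hi, Fin.val_castSucc]
      · intro k
        obtain ⟨l, rfl⟩ := π.surjective k
        rw [statW_insW_cast, hi]
        simp
    · obtain ⟨i, hi⟩ : ∃ i, (π.symm (Fin.last m)).succ = Fin.castSucc i :=
        ⟨⟨(π.symm (Fin.last m)).succ.val, by
          have : (π.symm (Fin.last m)).succ ≠ Fin.last (m + 1) := fun h => hj (hl.trans h.symm)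
          exact Fin.val_lt_last this⟩, rfl⟩
      have hg : gmap π j = Fin.castSucc (π i) := by
        rw [gmap, Equiv.trans_apply, hl, Equiv.swap_apply_right, hi, insW_last]
      have h2 := statW_after π i hi.symm
      rw [hg]
      apply eq_child
      · intro h; exact absurd h (Fin.castSucc_ne_last _)
      · intro k hk
        rw [← Fin.castSucc_injective _ hk, statW_insW_last, if_neg hj, h2, hl]
        simp
      · intro k
        obtain ⟨l, rfl⟩ := π.surjective k
        rw [statW_insW_cast, hl, if_neg (Fin.castSucc_ne_last _).symm]
        split_ifs with h
        · rw [← Fin.castSucc_injective _ h, h2]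
        · rfl

theorem exists_equiv (m : ℕ) : ∃ e : Equiv.Perm (Fin (m + 1)) ≃ Equiv.Perm (Fin (m + 1)),
    ∀ π, statW π = statC (e π) := by
  induction m with
  | zero =>
    refine ⟨Equiv.refl _, fun π => ?_⟩
    funext v
    have h : ∀ x : Fin 1, x.val = 0 := by intro x; omega
    simp [statW, statC, cls]
  | succ m ih =>
    obtain ⟨e, he⟩ := ih
    refine ⟨(Equiv.ofBijective _ (insW_bij (m + 1))).symm.trans
      ((Equiv.prodShear e gmap).trans (Equiv.ofBijective _ (insC_bij (m + 1)))), fun π => ?_⟩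
    obtain ⟨⟨ρ, j⟩, rfl⟩ := (Equiv.ofBijective _ (insW_bij (m + 1))).surjective π
    simp only [Equiv.trans_apply, Equiv.symm_apply_apply]
    simp only [Equiv.ofBijective_apply, Equiv.prodShear_apply]
    rw [statW_insW, statC_insC (Nat.succ_ne_zero m), he]

theorem word_eq {n : ℕ} (π : Equiv.Perm (Fin n)) (i : Fin n) : word π (i.val + 1) = (π i).val + 1 := by
  have : i.val + 1 ≤ n := i.isLt
  simp [word, this]

def tset {n : ℕ} (T : Fin n → Fin 4) (c : Fin 4) : Finset ℕ :=
  (Finset.univ.filter fun v => T v = c).image fun v => v.val + 1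

theorem mem_tsetW {n : ℕ} (π : Equiv.Perm (Fin n)) (c : Fin 4) (hc : c ≠ 0) (x : ℕ) :
    x ∈ tset (statW π) c ↔ ∃ i, (1 ≤ i ∧ i ≤ n - 1) ∧
      cls (word π i) (word π (i + 1) - 1) = c ∧ word π (i + 1) = x := by
  simp only [tset, Finset.mem_image, Finset.mem_filter, Finset.mem_univ, true_and]
  constructor
  · rintro ⟨v, hv, rfl⟩
    obtain ⟨k, rfl⟩ := π.surjective v
    have hk : k.val ≠ 0 := by
      intro h; rw [statW_zero π k h] at hv; exact hc hv.symm
    have h1 := word_eq π ⟨k.val - 1, by omega⟩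
    simp only [Nat.sub_add_cancel (Nat.one_le_iff_ne_zero.2 hk)] at h1
    refine ⟨k.val, by omega, ?_, ?_⟩
    · rw [word_eq, h1, ← hv, statW_succ π ⟨k.val - 1, by omega⟩ k (by simp; omega)]
      simp
    · exact word_eq π k
  · rintro ⟨i, hi, h, rfl⟩
    have h1 := word_eq π ⟨i - 1, by omega⟩
    have h2 := word_eq π ⟨i, by omega⟩
    simp only [Nat.sub_add_cancel hi.1] at h1 h2
    refine ⟨π ⟨i, by omega⟩, ?_, h2.symm⟩
    rw [← h, statW_succ π ⟨i - 1, by omega⟩ ⟨i, by omega⟩ (by simp; omega), h1, h2]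
    simp

theorem mem_tsetC {n : ℕ} (π : Equiv.Perm (Fin n)) (c : Fin 4) (hc : c ≠ 0) (x : ℕ) :
    x ∈ tset (statC π) c ↔ ∃ i, (2 ≤ i ∧ i ≤ n) ∧
      cls (i - 1) (word π i - 1) = c ∧ word π i = x := by
  simp only [tset, Finset.mem_image, Finset.mem_filter, Finset.mem_univ, true_and]
  constructor
  · rintro ⟨v, hv, rfl⟩
    obtain ⟨k, rfl⟩ := π.surjective v
    rw [statC_apply] at hv
    have hk : k.val ≠ 0 := by
      intro h; simp [h, cls] at hv; exact hc hv.symm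
    refine ⟨k.val + 1, by omega, ?_, word_eq π k⟩
    rw [word_eq, ← hv]
    simp
  · rintro ⟨i, hi, h, rfl⟩
    have h1 := word_eq π ⟨i - 1, by omega⟩
    simp only [Nat.sub_add_cancel (show 1 ≤ i by omega)] at h1
    refine ⟨π ⟨i - 1, by omega⟩, ?_, h1.symm⟩
    rw [← h, statC_apply, h1]
    simp

theorem cls_one {q v : ℕ} : cls q v = 1 ↔ q ≠ 0 ∧ q < v := by
  unfold cls; split_ifs <;> simp_all <;> omega

theorem cls_two {q v : ℕ} : cls q v = 2 ↔ q ≠ 0 ∧ v < q := by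
  unfold cls; split_ifs <;> simp_all <;> omega

theorem cls_three {q v : ℕ} : cls q v = 3 ↔ q ≠ 0 ∧ v = q := by
  unfold cls; split_ifs <;> simp_all <;> omega

theorem word_pos {n : ℕ} (π : Equiv.Perm (Fin n)) (i : ℕ) (h : 1 ≤ i) (h' : i ≤ n) :
    1 ≤ word π i := by simp [word, h, h']

theorem word_ne {n : ℕ} (π : Equiv.Perm (Fin n)) (i : ℕ) (h : 1 ≤ i) (h' : i ≤ n - 1) :
    word π i ≠ word π (i + 1) := by
  have h1 := word_eq π ⟨i - 1, by omega⟩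
  have h2 := word_eq π ⟨i, by omega⟩
  simp only [Nat.sub_add_cancel h] at h1 h2
  rw [h1, h2]
  intro h3
  have := π.injective (Fin.ext (Nat.succ_injective h3))
  simp at this
  omega

theorem bASC_eq {n : ℕ} (π : Equiv.Perm (Fin n)) : bASCSet π = tset (statW π) 1 := by
  ext x
  rw [mem_tsetW _ _ (by decide)]
  simp only [bASCSet, Finset.mem_image, Finset.mem_filter, Finset.mem_Icc, cls_one, and_assoc]
  refine exists_congr fun i => and_congr_right fun h1 => and_congr_right fun h2 => ?_
  have := word_pos π i h1 (by omega)
  rw [← and_assoc]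
  refine and_congr_left fun _ => ?_
  omega

theorem des_eq {n : ℕ} (π : Equiv.Perm (Fin n)) : desSet π = tset (statW π) 2 := by
  ext x
  rw [mem_tsetW _ _ (by decide)]
  simp only [desSet, Finset.mem_image, Finset.mem_filter, Finset.mem_Icc, cls_two, and_assoc]
  refine exists_congr fun i => and_congr_right fun h1 => and_congr_right fun h2 => ?_
  have := word_pos π i h1 (by omega)
  have := word_pos π (i + 1) (by omega) (by omega)
  have := word_ne π i h1 h2
  rw [← and_assoc]
  refine and_congr_left fun _ => ?_
  omega

theorem suc_eq {n : ℕ} (π : Equiv.Perm (Fin n)) : sucSet π = tset (statW π) 3 := by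
  ext x
  rw [mem_tsetW _ _ (by decide)]
  simp only [sucSet, Finset.mem_image, Finset.mem_filter, Finset.mem_Icc, cls_three, and_assoc]
  refine exists_congr fun i => and_congr_right fun h1 => and_congr_right fun h2 => ?_
  have := word_pos π i h1 (by omega)
  rw [← and_assoc]
  refine and_congr_left fun _ => ?_
  omega

theorem exc_eq {n : ℕ} (π : Equiv.Perm (Fin n)) : excHatSet π = tset (statC π) 1 := by
  ext x
  rw [mem_tsetC _ _ (by decide)]
  simp only [excHatSet, Finset.mem_image, Finset.mem_filter, Finset.mem_Icc, cls_one, and_assoc]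
  refine exists_congr fun i => and_congr_right fun h1 => and_congr_right fun h2 => ?_
  rw [← and_assoc]
  refine and_congr_left fun _ => ?_
  omega

theorem drop_eq {n : ℕ} (π : Equiv.Perm (Fin n)) : dropSet π = tset (statC π) 2 := by
  ext x
  rw [mem_tsetC _ _ (by decide)]
  simp only [dropSet, Finset.mem_image, Finset.mem_filter, Finset.mem_Icc, cls_two, and_assoc]
  refine exists_congr fun i => and_congr_right fun h1 => and_congr_right fun h2 => ?_
  have := word_pos π i (by omega) h2
  rw [← and_assoc]
  refine and_congr_left fun _ => ?_
  omega

theorem fix_eq {n : ℕ} (π : Equiv.Perm (Fin n)) : fixHatSet π = tset (statC π) 3 := by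
  ext x
  rw [mem_tsetC _ _ (by decide)]
  simp only [fixHatSet, Finset.mem_filter, Finset.mem_Icc, cls_three]
  constructor
  · rintro ⟨h, h'⟩
    exact ⟨x, h, by omega, h'⟩
  · rintro ⟨i, h, h', h''⟩
    have := word_pos π i (by omega) h.2
    have : i = x := by omega
    subst this
    exact ⟨h, h''⟩

/-- the triple set-valued statistics `(bASC, Des, Suc)` and
`(Êxc, Drop, F̂ix)` are equidistributed over `S_n`. -/
theorem statement1 (n : ℕ) (hn : 1 ≤ n) (X Y Z : Finset ℕ)
    (hX : X ⊆ Finset.Icc 1 n) (hY : Y ⊆ Finset.Icc 1 n) (hZ : Z ⊆ Finset.Icc 1 n) :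
    (Finset.univ.filter fun π : Equiv.Perm (Fin n) =>
        bASCSet π = X ∧ desSet π = Y ∧ sucSet π = Z).card =
      (Finset.univ.filter fun π : Equiv.Perm (Fin n) =>
        excHatSet π = X ∧ dropSet π = Y ∧ fixHatSet π = Z).card := by
  obtain ⟨m, rfl⟩ : ∃ m, n = m + 1 := ⟨n - 1, by omega⟩
  obtain ⟨e, he⟩ := exists_equiv m
  refine Finset.card_equiv e fun π => ?_
  simp only [Finset.mem_filter, Finset.mem_univ, true_and, bASC_eq, des_eq, suc_eq, exc_eq,
    drop_eq, fix_eq, he]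

end SucEuler
end
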